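/- Let Y be a centered log-concave real random variable. Then for all p ≥ q ≥ 2, (E|Y|^p)^{1/p} ≤ 2·(p/q)·(E|Y|^q)^{1/q}. -/

import Mathlib

open MeasureTheory Real
open scoped Pointwise

noncomputable section

variable {Ω : Type*} [MeasurableSpace Ω]

/-- A real random variable `Y` is log-concave: for all nonempty compact sets `K, L ⊆ ℝ` and
`a ∈ [0,1]`, `P(Y ∈ aK + (1-a)L) ≥ P(Y ∈ K)^a * P(Y ∈ L)^(1-a)`. -/
def IsLogConcaveRV (μ : Measure Ω) (Y : Ω → ℝ) : Prop :=
  ∀ K L : Set ℝ, K.Nonempty → L.Nonempty → IsCompact K → IsCompact L →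
    ∀ a : ℝ, 0 ≤ a → a ≤ 1 →
      (μ (Y ⁻¹' K)).toReal ^ a * (μ (Y ⁻¹' L)).toReal ^ (1 - a) ≤
        (μ (Y ⁻¹' (a • K + (1 - a) • L))).toReal

/-- The multiplicative form of log-concavity for a nonnegative function on the line. -/
def IsLogConcaveFun (G : ℝ → ℝ) : Prop :=
  ∀ s t a : ℝ, 0 ≤ a → a ≤ 1 → G s ^ a * G t ^ (1 - a) ≤ G (a * s + (1 - a) * t)

/-- The upper tail `t ↦ P(Y ≥ t)`. -/
def upperTail (μ : Measure Ω) (Y : Ω → ℝ) (t : ℝ) : ℝ := μ.real {ω | t ≤ Y ω}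

theorem IsLogConcaveRV.neg {μ : Measure Ω} {Y : Ω → ℝ} (h : IsLogConcaveRV μ Y) :
    IsLogConcaveRV μ (fun ω => -Y ω) := by
  intro K L hK hL hKc hLc a ha0 ha1
  have key := h (-K) (-L) hK.neg hL.neg hKc.neg hLc.neg a ha0 ha1
  have e : a • (-K) + (1 - a) • (-L) = -(a • K + (1 - a) • L) := by
    rw [Set.smul_set_neg, Set.smul_set_neg, neg_add]
  rw [e] at key
  exact key

theorem upperTail_nonneg {μ : Measure Ω} {Y : Ω → ℝ} (t : ℝ) : 0 ≤ upperTail μ Y t :=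
  measureReal_nonneg

section UpperTail

variable {μ : Measure Ω} [IsProbabilityMeasure μ] {Y : Ω → ℝ}

theorem upperTail_antitone : Antitone (upperTail μ Y) := fun _ _ hst =>
  measureReal_mono fun _ hω => hst.trans hω

theorem ofReal_upperTail (t : ℝ) : ENNReal.ofReal (upperTail μ Y t) = μ {ω | t ≤ Y ω} :=
  ofReal_measureReal

theorem IsLogConcaveRV.upperTail (h : IsLogConcaveRV μ Y) :
    IsLogConcaveFun (upperTail μ Y) := by
  intro s t a ha0 ha1
  have lim : ∀ s : ℝ, Filter.Tendsto (fun n : ℕ => μ.real (Y ⁻¹' Set.Icc s (s + n)))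
      Filter.atTop (nhds (_root_.upperTail μ Y s)) := by
    intro s
    have hmono : Monotone fun n : ℕ => Y ⁻¹' Set.Icc s (s + n) := by
      intro m n hmn
      refine Set.preimage_mono (Set.Icc_subset_Icc_right ?_)
      gcongr
    have hU : (⋃ n : ℕ, Y ⁻¹' Set.Icc s (s + n)) = {ω | s ≤ Y ω} := by
      ext ω
      simp only [Set.mem_iUnion, Set.mem_preimage, Set.mem_Icc, Set.mem_ofPred_eq]
      refine ⟨fun ⟨n, hn⟩ => hn.1, fun hs => ?_⟩
      obtain ⟨n, hn⟩ := exists_nat_ge (Y ω - s)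
      exact ⟨n, hs, by linarith⟩
    have := tendsto_measure_iUnion_atTop (μ := μ) hmono
    rw [hU] at this
    exact (ENNReal.tendsto_toReal (measure_ne_top _ _)).comp this
  have l := ((lim s).rpow_const (p := a) (Or.inr ha0)).mul
    ((lim t).rpow_const (p := 1 - a) (Or.inr (by linarith)))
  refine le_of_tendsto' l fun n => ?_
  have hn : (0 : ℝ) ≤ n := n.cast_nonneg
  refine (h (Set.Icc s (s + n)) (Set.Icc t (t + n)) (Set.nonempty_Icc.2 (by linarith))
    (Set.nonempty_Icc.2 (by linarith)) isCompact_Icc isCompact_Icc a ha0 ha1).trans ?_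
  refine measureReal_mono ?_
  rintro ω ⟨_, ⟨x, hx, rfl⟩, _, ⟨y, hy, rfl⟩, hxy⟩
  simp only [smul_eq_mul] at hxy
  change a * s + (1 - a) * t ≤ Y ω
  rw [← hxy]
  have h1 : 0 ≤ 1 - a := by linarith
  have := mul_le_mul_of_nonneg_left hx.1 ha0
  have := mul_le_mul_of_nonneg_left hy.1 h1
  linarith

/-- The probability integral transform of the upper tail dominates the uniform law. -/
theorem measure_upperTail_lt_le (hY : Measurable Y) (u : ℝ) :
    μ {ω | upperTail μ Y (Y ω) < u} ≤ ENNReal.ofReal u := by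
  have hS : MeasurableSet {y | upperTail μ Y y < u} :=
    upperTail_antitone.measurable measurableSet_Iio
  have : IsProbabilityMeasure (μ.map Y) := Measure.isProbabilityMeasure_map hY.aemeasurable
  have e : μ {ω | upperTail μ Y (Y ω) < u} = μ.map Y {y | upperTail μ Y y < u} := by
    rw [Measure.map_apply hY hS]; rfl
  rw [e, hS.measure_eq_iSup_isCompact]
  refine iSup_le fun K => iSup_le fun hK => iSup_le fun hKc => ?_
  rcases K.eq_empty_or_nonempty with rfl | hne
  · simp
  obtain ⟨m, hm, hmin⟩ := hKc.exists_isLeast hne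
  rw [Measure.map_apply hY hKc.measurableSet]
  calc μ (Y ⁻¹' K) ≤ μ {ω | m ≤ Y ω} := measure_mono fun ω hω => hmin hω
    _ = ENNReal.ofReal (upperTail μ Y m) := (ofReal_upperTail m).symm
    _ ≤ ENNReal.ofReal u := ENNReal.ofReal_le_ofReal (le_of_lt (hK hm))

theorem lintegral_upperTail_rpow_le (hY : Measurable Y) :
    ∫⁻ ω, ENNReal.ofReal (upperTail μ Y (Y ω) ^ (-(1 / 6) : ℝ)) ∂μ ≤ ENNReal.ofReal (6 / 5) := by
  rw [lintegral_eq_lintegral_meas_lt μ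
    (Filter.Eventually.of_forall fun ω => rpow_nonneg (upperTail_nonneg _) _)
    ((upperTail_antitone.measurable.comp hY).pow_const _).aemeasurable]
  rw [← Set.Ioc_union_Ioi_eq_Ioi (zero_le_one (α := ℝ)),
    lintegral_union measurableSet_Ioi Set.Ioc_disjoint_Ioi_same]
  have h1 : ∫⁻ t in Set.Ioc (0 : ℝ) 1,
      μ {ω | t < upperTail μ Y (Y ω) ^ (-(1 / 6) : ℝ)} ≤ ENNReal.ofReal 1 := by
    refine (lintegral_mono fun t => prob_le_one).trans ?_
    simp
  have h2 : ∫⁻ t in Set.Ioi (1 : ℝ),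
      μ {ω | t < upperTail μ Y (Y ω) ^ (-(1 / 6) : ℝ)} ≤ ENNReal.ofReal (1 / 5) := by
    calc _ ≤ ∫⁻ t in Set.Ioi (1 : ℝ), ENNReal.ofReal (t ^ (-6 : ℝ)) := by
          refine setLIntegral_mono' measurableSet_Ioi fun t ht => ?_
          have ht0 : (0 : ℝ) < t := zero_lt_one.trans ht
          refine (measure_mono fun ω hω => ?_).trans (measure_upperTail_lt_le hY (t ^ (-6 : ℝ)))
          simp only [Set.mem_ofPred_eq] at hω ⊢
          rcases (upperTail_nonneg (μ := μ) (Y := Y) (Y ω)).eq_or_lt with h0 | h0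
          · rw [← h0]; positivity
          have := rpow_lt_rpow_of_neg ht0 hω (by norm_num : (-6 : ℝ) < 0)
          rwa [← rpow_mul h0.le, show (-(1 / 6) : ℝ) * -6 = 1 by norm_num, rpow_one] at this
      _ = ENNReal.ofReal (1 / 5) := by
          rw [← ofReal_integral_eq_lintegral_ofReal
            (integrableOn_Ioi_rpow_of_lt (by norm_num) zero_lt_one)
            ((ae_restrict_mem measurableSet_Ioi).mono fun t ht =>
              rpow_nonneg (zero_le_one.trans (le_of_lt ht)) _),
            integral_Ioi_rpow_of_lt (by norm_num) zero_lt_one]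
          norm_num
  refine (add_le_add h1 h2).trans ?_
  rw [← ENNReal.ofReal_add (by norm_num) (by norm_num)]
  norm_num

end UpperTail

section LogConcaveFun

variable {G : ℝ → ℝ}

/-- A decreasing log-concave function has a supporting exponential at the origin. -/
theorem IsLogConcaveFun.exists_le_mul_exp (hG : IsLogConcaveFun G) (hnn : ∀ t, 0 ≤ G t)
    (hanti : Antitone G) {t₀ : ℝ} (ht₀ : 0 < t₀) (hpos : 0 < G t₀) :
    ∃ c : ℝ, ∀ t, G t ≤ G 0 * exp (c * t) := by
  have h0 : 0 < G 0 := hpos.trans_le (hanti ht₀.le)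
  have hneg : ∀ s < 0, 0 < G s := fun s hs => h0.trans_le (hanti hs.le)
  have slope : ∀ s < 0, ∀ t > 0, 0 < G t →
      (log (G t) - log (G 0)) / t ≤ (log (G 0) - log (G s)) / (-s) := by
    intro s hs t ht hGt
    have hd : 0 < t - s := by linarith
    have key := hG s t (t / (t - s)) (by positivity) (by rw [div_le_one hd]; linarith)
    have e1 : 1 - t / (t - s) = -s / (t - s) := by field_simp; ring
    have e2 : t / (t - s) * s + -s / (t - s) * t = 0 := by field_simp; ring
    rw [e1, e2] at key
    have hl := log_le_log (mul_pos (rpow_pos_of_pos (hneg s hs) _) (rpow_pos_of_pos hGt _)) key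
    rw [log_mul (rpow_pos_of_pos (hneg s hs) _).ne' (rpow_pos_of_pos hGt _).ne',
      log_rpow (hneg s hs), log_rpow hGt, div_mul_eq_mul_div, div_mul_eq_mul_div, ← add_div,
      div_le_iff₀ hd] at hl
    rw [div_le_div_iff₀ ht (by linarith)]
    linarith
  set S : Set ℝ := (fun s => (log (G 0) - log (G s)) / (-s)) '' Set.Iio 0
  have hSne : S.Nonempty := Set.nonempty_Iio.image _
  have hSbdd : BddBelow S := by
    refine ⟨(log (G t₀) - log (G 0)) / t₀, ?_⟩
    rintro _ ⟨s, hs, rfl⟩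
    exact slope s hs t₀ ht₀ hpos
  have of_log : ∀ t, 0 < G t → log (G t) ≤ log (G 0) + sInf S * t →
      G t ≤ G 0 * exp (sInf S * t) := by
    intro t hGt hle
    rw [← exp_log hGt]
    calc exp (log (G t)) ≤ exp (log (G 0) + sInf S * t) := exp_le_exp.2 hle
      _ = _ := by rw [exp_add, exp_log h0]
  refine ⟨sInf S, fun t => ?_⟩
  rcases lt_trichotomy t 0 with ht | rfl | ht
  · refine of_log t (hneg t ht) ?_
    have := csInf_le hSbdd (Set.mem_image_of_mem _ ht)
    rw [le_div_iff₀ (by linarith)] at this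
    linarith
  · simp
  · rcases (hnn t).eq_or_lt with hz | hGt
    · rw [← hz]; positivity
    refine of_log t hGt ?_
    have : (log (G t) - log (G 0)) / t ≤ sInf S := by
      refine le_csInf hSne ?_
      rintro _ ⟨s, hs, rfl⟩
      exact slope s hs t ht hGt
    rw [div_le_iff₀ ht] at this
    linarith

theorem IsLogConcaveFun.apply_mul_le (hG : IsLogConcaveFun G) (hnn : ∀ t, 0 ≤ G t)
    (h0 : 0 < G 0) {r : ℝ} (hr : 1 ≤ r) (u : ℝ) :
    G (r * u) ≤ G 0 ^ (1 - r) * G u ^ r := by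
  have hr0 : 0 < r := by linarith
  have key := hG (r * u) 0 (1 / r) (by positivity) (by rw [div_le_one hr0]; exact hr)
  rw [show 1 / r * (r * u) + (1 - 1 / r) * 0 = u by field_simp; ring] at key
  have := rpow_le_rpow (mul_nonneg (rpow_nonneg (hnn _) _) (rpow_nonneg (hnn _) _)) key hr0.le
  rw [mul_rpow (rpow_nonneg (hnn _) _) (rpow_nonneg (hnn _) _), ← rpow_mul (hnn _),
    ← rpow_mul (hnn _), one_div_mul_cancel hr0.ne', rpow_one,
    show (1 - 1 / r) * r = -(1 - r) by field_simp; ring, rpow_neg h0.le,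
    ← div_eq_mul_inv, div_le_iff₀ (rpow_pos_of_pos h0 _)] at this
  linarith

/-- A log-concave function that decreases strictly somewhere decays exponentially. -/
theorem IsLogConcaveFun.exists_exp_decay (hG : IsLogConcaveFun G) (hnn : ∀ t, 0 ≤ G t)
    (hanti : Antitone G) {u : ℝ} (hu : 0 < u) (hlt : G u < G 0) :
    ∃ C b : ℝ, 0 < b ∧ ∀ t > 0, G t ≤ C * exp (-b * t) := by
  have h0 : 0 < G 0 := (hnn u).trans_lt hlt
  obtain ⟨v, huv, hv0⟩ := exists_between hlt
  have hv : 0 < v := (hnn u).trans_lt huv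
  have hl : log (v / G 0) < 0 := log_neg (by positivity) (by rwa [div_lt_one h0])
  refine ⟨G 0 * exp (-log (v / G 0)), -log (v / G 0) / u, div_pos (by linarith) hu,
    fun t ht => ?_⟩
  have e : G 0 * exp (-log (v / G 0)) * exp (-(-log (v / G 0) / u) * t) =
      G 0 * exp (log (v / G 0) * (t / u - 1)) := by
    rw [mul_assoc, ← exp_add]; congr 2; field_simp; ring
  rw [e]
  rcases le_total t u with htu | htu
  · refine (hanti ht.le).trans (le_mul_of_one_le_right h0.le (one_le_exp ?_))
    have : t / u ≤ 1 := by rwa [div_le_one hu]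
    nlinarith
  · have h1 : 1 ≤ t / u := by rwa [one_le_div hu]
    have := hG.apply_mul_le hnn h0 h1 u
    rw [div_mul_cancel₀ _ hu.ne'] at this
    calc G t ≤ G 0 ^ (1 - t / u) * G u ^ (t / u) := this
      _ ≤ G 0 ^ (1 - t / u) * v ^ (t / u) := by gcongr; exact hnn u
      _ = G 0 * exp (log (v / G 0) * (t / u)) := by
        rw [rpow_sub h0, rpow_one, ← rpow_def_of_pos (by positivity), div_rpow hv.le h0.le]
        ring
      _ ≤ _ := by
        refine mul_le_mul_of_nonneg_left (exp_le_exp.2 ?_) h0.le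
        linarith

end LogConcaveFun

section Moments

variable {μ : Measure Ω} [IsProbabilityMeasure μ] {Y : Ω → ℝ}

theorem tendsto_upperTail_atTop (hY : Measurable Y) :
    Filter.Tendsto (fun n : ℕ => upperTail μ Y n) Filter.atTop (nhds 0) := by
  have hanti : Antitone fun n : ℕ => {ω | (n : ℝ) ≤ Y ω} := fun m n hmn ω hω =>
    le_trans (Nat.cast_le.2 hmn) (show (n : ℝ) ≤ Y ω from hω)
  have hI : (⋂ n : ℕ, {ω | (n : ℝ) ≤ Y ω}) = ∅ := by
    ext ω
    simp only [Set.mem_iInter, Set.mem_ofPred_eq, Set.mem_empty_iff_false, iff_false, not_forall,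
      not_le]
    exact exists_nat_gt _
  have := tendsto_measure_iInter_atTop (μ := μ)
    (fun n : ℕ => (measurableSet_le measurable_const hY).nullMeasurableSet) hanti
    ⟨0, measure_ne_top _ _⟩
  rw [hI, measure_empty] at this
  exact (ENNReal.tendsto_toReal ENNReal.zero_ne_top).comp this

theorem setOf_le_max_zero_div {α : Type*} {Y : α → ℝ} {t r : ℝ} (ht : 0 < t) (hr : 0 < r) :
    {ω | t ≤ max (Y ω) 0 / r} = {ω | r * t ≤ Y ω} := by
  ext ω
  have : ¬ r * t ≤ 0 := not_le.2 (mul_pos hr ht)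
  simp [le_div_iff₀ hr, mul_comm t r, this]

theorem integrable_max_zero_rpow (hY : Measurable Y) (hlc : IsLogConcaveRV μ Y) {p : ℝ}
    (hp : 0 < p) : Integrable (fun ω => max (Y ω) 0 ^ p) μ := by
  have hm : Measurable fun ω => max (Y ω) 0 := hY.max measurable_const
  have hX : ∀ ω, 0 ≤ max (Y ω) 0 := fun ω => le_max_right _ _
  have hnn : ∀ ω, 0 ≤ max (Y ω) 0 ^ p := fun ω => rpow_nonneg (hX ω) _
  have hdecay : ∃ C b : ℝ, 0 < b ∧ ∀ t > 0, upperTail μ Y t ≤ C * exp (-b * t) := by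
    rcases (upperTail_nonneg (μ := μ) (Y := Y) 0).eq_or_lt with h0 | h0
    · refine ⟨0, 1, one_pos, fun t ht => ?_⟩
      rw [zero_mul]
      refine le_of_le_of_eq ?_ h0.symm
      exact upperTail_antitone (μ := μ) (Y := Y) ht.le
    · obtain ⟨n, hn, hn1⟩ := (((tendsto_upperTail_atTop (μ := μ) hY).eventually_lt_const h0).and
        (Filter.eventually_gt_atTop 0)).exists
      exact hlc.upperTail.exists_exp_decay upperTail_nonneg upperTail_antitone
        (Nat.cast_pos.2 hn1) hn
  obtain ⟨C, b, hb, hdec⟩ := hdecay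
  refine ⟨(hm.pow_const _).aestronglyMeasurable, ?_⟩
  rw [hasFiniteIntegral_iff_ofReal (Filter.Eventually.of_forall hnn),
    lintegral_rpow_eq_lintegral_meas_le_mul μ (Filter.Eventually.of_forall hX) hm.aemeasurable hp]
  refine ENNReal.mul_lt_top ENNReal.ofReal_lt_top ?_
  have hint : IntegrableOn (fun t : ℝ => C * (t ^ (p - 1) * exp (-b * t ^ (1 : ℝ))))
      (Set.Ioi 0) :=
    (integrableOn_rpow_mul_exp_neg_mul_rpow (by linarith) one_pos hb).const_mul C
  refine lt_of_le_of_lt (setLIntegral_mono' measurableSet_Ioi fun t ht => ?_) hint.lintegral_lt_top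
  have ht : 0 < t := ht
  have e := setOf_le_max_zero_div (Y := Y) ht one_pos
  simp only [div_one, one_mul] at e
  rw [e, ← ofReal_upperTail, ← ENNReal.ofReal_mul (upperTail_nonneg _), rpow_one]
  refine ENNReal.ofReal_le_ofReal ?_
  calc upperTail μ Y t * t ^ (p - 1) ≤ C * exp (-b * t) * t ^ (p - 1) := by
        gcongr; exact hdec t ht
    _ = _ := by ring

/-- Comparison of the moments of the positive part of a log-concave variable. -/
theorem integral_max_zero_rpow_le (hY : Measurable Y) (hlc : IsLogConcaveRV μ Y)
    (h0 : 0 < upperTail μ Y 0) {p q : ℝ} (hq : 0 < q) (hpq : q ≤ p) :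
    ∫ ω, max (Y ω) 0 ^ p ∂μ ≤
      (p / q) ^ p * (p / q) * upperTail μ Y 0 ^ (1 - p / q) *
        (∫ ω, max (Y ω) 0 ^ q ∂μ) ^ (p / q) := by
  set r := p / q with hr
  set a := upperTail μ Y 0
  set M := ∫ ω, max (Y ω) 0 ^ q ∂μ
  have hp : 0 < p := hq.trans_le hpq
  have hr1 : 1 ≤ r := (one_le_div hq).2 hpq
  have hr0 : 0 < r := by linarith
  have hm : Measurable fun ω => max (Y ω) 0 := hY.max measurable_const
  have hX : ∀ ω, 0 ≤ max (Y ω) 0 := fun ω => le_max_right _ _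
  have hiq := integrable_max_zero_rpow hY hlc hq
  have hip := integrable_max_zero_rpow hY hlc hp
  have hM : 0 ≤ M := integral_nonneg fun ω => rpow_nonneg (hX ω) _
  have hset : ∀ t > 0, {ω | t ≤ max (Y ω) 0} = {ω | t ≤ Y ω} := fun t ht => by
    simpa using setOf_le_max_zero_div (Y := Y) ht one_pos
  have markov : ∀ u > 0, u ^ q * upperTail μ Y u ≤ M := by
    intro u hu
    have := mul_meas_ge_le_integral_of_nonneg
      (Filter.Eventually.of_forall fun ω => rpow_nonneg (hX ω) q) hiq (u ^ q)
    simp only [rpow_le_rpow_iff hu.le (hX _) hq] at this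
    rwa [hset u hu] at this
  have hpt : ∀ u > 0, upperTail μ Y (r * u) * u ^ (p - 1) ≤
      a ^ (1 - r) * M ^ (r - 1) * (upperTail μ Y u * u ^ (q - 1)) := by
    intro u hu
    have hg := upperTail_nonneg (μ := μ) (Y := Y) u
    have e1 : upperTail μ Y u ^ r * u ^ (p - 1) =
        (u ^ q * upperTail μ Y u) ^ (r - 1) * (upperTail μ Y u * u ^ (q - 1)) := by
      rw [mul_rpow (by positivity) hg, ← rpow_mul hu.le,
        show p - 1 = q * (r - 1) + (q - 1) by rw [hr]; field_simp; ring, rpow_add hu]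
      rcases hg.eq_or_lt with hz | hz
      · simp [← hz, hr0.ne']
      · have : upperTail μ Y u ^ r = upperTail μ Y u ^ (r - 1) * upperTail μ Y u := by
          rw [← rpow_add_one hz.ne']; congr 1; ring
        rw [this]; ring
    calc upperTail μ Y (r * u) * u ^ (p - 1)
        ≤ a ^ (1 - r) * upperTail μ Y u ^ r * u ^ (p - 1) := by
          gcongr
          exact hlc.upperTail.apply_mul_le upperTail_nonneg h0 hr1 u
      _ = a ^ (1 - r) *
          ((u ^ q * upperTail μ Y u) ^ (r - 1) * (upperTail μ Y u * u ^ (q - 1))) := by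
          rw [mul_assoc, e1]
      _ ≤ a ^ (1 - r) * (M ^ (r - 1) * (upperTail μ Y u * u ^ (q - 1))) := by
          gcongr
          exact markov u hu
      _ = _ := by ring
  have hK : 0 ≤ a ^ (1 - r) * M ^ (r - 1) := by positivity
  have hJ := lintegral_rpow_eq_lintegral_meas_le_mul μ (Filter.Eventually.of_forall hX)
    hm.aemeasurable hq
  rw [← ofReal_integral_eq_lintegral_ofReal hiq
    (Filter.Eventually.of_forall fun ω => rpow_nonneg (hX ω) q)] at hJ
  have hI := lintegral_rpow_eq_lintegral_meas_le_mul μ (f := fun ω => max (Y ω) 0 / r)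
    (Filter.Eventually.of_forall fun ω => div_nonneg (hX ω) hr0.le)
    (hm.div_const r).aemeasurable hp
  have hdiv : ∀ ω, (max (Y ω) 0 / r) ^ p = max (Y ω) 0 ^ p / r ^ p := fun ω =>
    div_rpow (hX ω) hr0.le p
  simp only [hdiv] at hI
  rw [← ofReal_integral_eq_lintegral_ofReal (hip.div_const _)
    (Filter.Eventually.of_forall fun ω => div_nonneg (rpow_nonneg (hX ω) p) (by positivity)),
    integral_div] at hI
  have hle : ENNReal.ofReal ((∫ ω, max (Y ω) 0 ^ p ∂μ) / r ^ p) ≤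
      ENNReal.ofReal (r * (a ^ (1 - r) * M ^ (r - 1)) * M) := by
    rw [hI, ENNReal.ofReal_mul (by positivity), hJ, ENNReal.ofReal_mul hr0.le]
    calc _ ≤ ENNReal.ofReal p * ∫⁻ t in Set.Ioi 0, ENNReal.ofReal (a ^ (1 - r) * M ^ (r - 1)) *
          (μ {ω | t ≤ max (Y ω) 0} * ENNReal.ofReal (t ^ (q - 1))) := by
          gcongr ENNReal.ofReal p * ?_
          refine setLIntegral_mono' measurableSet_Ioi fun t ht => ?_
          have ht : 0 < t := ht
          rw [setOf_le_max_zero_div ht hr0, hset t ht, ← ofReal_upperTail, ← ofReal_upperTail,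
            ← ENNReal.ofReal_mul (upperTail_nonneg _), ← ENNReal.ofReal_mul (upperTail_nonneg _),
            ← ENNReal.ofReal_mul hK]
          exact ENNReal.ofReal_le_ofReal (hpt t ht)
      _ = _ := by
          rw [lintegral_const_mul' _ _ ENNReal.ofReal_ne_top,
            show ENNReal.ofReal p = ENNReal.ofReal r * ENNReal.ofReal q by
              rw [← ENNReal.ofReal_mul hr0.le, hr, div_mul_cancel₀ _ hq.ne']]
          ring
  rw [ENNReal.ofReal_le_ofReal_iff (by positivity), div_le_iff₀ (by positivity)] at hle
  refine hle.trans (le_of_eq ?_)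
  have : M ^ r = M ^ (r - 1) * M := by
    rcases hM.eq_or_lt with hz | hz
    · simp [← hz, hr0.ne']
    · rw [← rpow_add_one hz.ne']; congr 1; ring
  rw [this]; ring

/-- A Grünbaum-type bound: a centered log-concave variable is nonnegative with probability at
least `1/3`. -/
theorem one_third_le_upperTail_zero (hY : Measurable Y) (hlc : IsLogConcaveRV μ Y)
    (hint : Integrable Y μ) (hcent : ∫ ω, Y ω ∂μ = 0) : 1 / 3 ≤ upperTail μ Y 0 := by
  by_cases hex : ∃ t > 0, 0 < upperTail μ Y t
  swap
  · push Not at hex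
    have hle : ∀ᵐ ω ∂μ, 0 ≤ -Y ω := by
      have : ∀ n : ℕ, ∀ᵐ ω ∂μ, Y ω < 1 / (n + 1 : ℝ) := fun n => by
        have h := (hex (1 / (n + 1 : ℝ)) (by positivity)).antisymm (upperTail_nonneg _)
        have h' := ofReal_upperTail (μ := μ) (Y := Y) (1 / (n + 1 : ℝ))
        rw [h, ENNReal.ofReal_zero] at h'
        rw [ae_iff]
        simpa only [not_lt] using h'.symm
      filter_upwards [ae_all_iff.2 this] with ω hω
      by_contra! hpos
      obtain ⟨n, hn⟩ := exists_nat_one_div_lt (neg_lt_zero.1 hpos)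
      exact lt_asymm hn (hω n)
    have hz : (fun ω => -Y ω) =ᵐ[μ] 0 := by
      rw [← integral_eq_zero_iff_of_nonneg_ae hle hint.neg, integral_neg, hcent, neg_zero]
    have hone : upperTail μ Y 0 = 1 := by
      have : {ω | 0 ≤ Y ω} =ᵐ[μ] Set.univ := by
        rw [Filter.eventuallyEq_univ]
        filter_upwards [hz] with ω hω
        exact (neg_eq_zero.1 hω).ge
      rw [upperTail, measureReal_congr this, probReal_univ]
    rw [hone]
    norm_num
  obtain ⟨t₀, ht₀, hpos⟩ := hex
  have h0 : 0 < upperTail μ Y 0 := hpos.trans_le (upperTail_antitone ht₀.le)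
  obtain ⟨c, hc⟩ := hlc.upperTail.exists_le_mul_exp upperTail_nonneg upperTail_antitone ht₀ hpos
  set a := upperTail μ Y 0
  set f : Ω → ℝ := fun ω => upperTail μ Y (Y ω) ^ (-(1 / 6) : ℝ)
  have hf : ∀ ω, 0 ≤ f ω := fun ω => rpow_nonneg (upperTail_nonneg _) _
  have hfm : Measurable f := (upperTail_antitone.measurable.comp hY).pow_const _
  have hfint : Integrable f μ := by
    refine ⟨hfm.aestronglyMeasurable, ?_⟩
    rw [hasFiniteIntegral_iff_ofReal (Filter.Eventually.of_forall hf)]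
    exact (lintegral_upperTail_rpow_le hY).trans_lt ENNReal.ofReal_lt_top
  have hfle : ∫ ω, f ω ∂μ ≤ 6 / 5 := by
    rw [← ENNReal.ofReal_le_ofReal_iff (by norm_num),
      ofReal_integral_eq_lintegral_ofReal hfint (Filter.Eventually.of_forall hf)]
    exact lintegral_upperTail_rpow_le hY
  have hpos_ae : ∀ᵐ ω ∂μ, 0 < upperTail μ Y (Y ω) := by
    have hle : ∀ u > 0, μ {ω | ¬ 0 < upperTail μ Y (Y ω)} ≤ ENNReal.ofReal u := fun u hu =>
      (measure_mono fun ω hω => (not_lt.1 hω).trans_lt hu).trans (measure_upperTail_lt_le hY u)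
    rw [ae_iff, ← nonpos_iff_eq_zero]
    refine le_of_forall_gt fun ε hε => ?_
    obtain ⟨u, hu, huε⟩ := ENNReal.lt_iff_exists_nnreal_btwn.1 hε
    refine lt_of_le_of_lt ?_ huε
    have := hle u (by exact_mod_cast hu)
    rwa [ENNReal.ofReal_coe_nnreal] at this
  have hae : ∀ᵐ ω ∂μ, 1 - c / 6 * Y ω ≤ a ^ (1 / 6 : ℝ) * f ω := by
    filter_upwards [hpos_ae] with ω hω
    have h1 : (a * exp (c * Y ω)) ^ (-(1 / 6) : ℝ) ≤ f ω :=
      rpow_le_rpow_of_nonpos hω (hc _) (by norm_num)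
    rw [mul_rpow h0.le (exp_pos _).le, ← exp_mul, rpow_neg h0.le] at h1
    have h2 := mul_le_mul_of_nonneg_left h1 (rpow_nonneg h0.le (1 / 6))
    rw [mul_inv_cancel_left₀ (rpow_pos_of_pos h0 _).ne'] at h2
    refine le_trans ?_ h2
    have := add_one_le_exp (c * Y ω * -(1 / 6))
    linarith
  have hI := integral_mono_ae ((integrable_const 1).sub (hint.const_mul (c / 6)))
    (hfint.const_mul _) hae
  simp only [Pi.sub_apply] at hI
  rw [integral_sub (integrable_const 1) (hint.const_mul _), integral_const_mul,
    integral_const_mul, hcent] at hI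
  simp only [integral_const, probReal_univ, smul_eq_mul, mul_one, mul_zero, sub_zero] at hI
  have h56 : 5 / 6 ≤ a ^ (1 / 6 : ℝ) := by
    have := mul_le_mul_of_nonneg_left hfle (rpow_nonneg h0.le (1 / 6))
    linarith
  have h6 : (a ^ (1 / 6 : ℝ)) ^ 6 = a := by
    rw [← rpow_natCast, ← rpow_mul h0.le]; norm_num
  rw [← h6]
  exact le_trans (by norm_num) (pow_le_pow_left₀ (by norm_num) h56 6)

theorem abs_rpow_eq_max_add_max {p : ℝ} (hp : 0 < p) (x : ℝ) :
    |x| ^ p = max x 0 ^ p + max (-x) 0 ^ p := by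
  rcases le_total 0 x with hx | hx
  · rw [abs_of_nonneg hx, max_eq_left hx, max_eq_right (by linarith), zero_rpow hp.ne', add_zero]
  · rw [abs_of_nonpos hx, max_eq_right hx, max_eq_left (by linarith), zero_rpow hp.ne', zero_add]

end Moments

theorem mul_three_rpow_le_four_rpow {r : ℝ} (hr : 1 ≤ r) : r * 3 ^ (r - 1) ≤ (4 : ℝ) ^ r := by
  have hb := one_add_mul_self_le_rpow_one_add (s := 1 / 3) (by norm_num) hr
  have e : (4 : ℝ) ^ r = 3 * 3 ^ (r - 1) * (1 + 1 / 3) ^ r := by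
    rw [show (4 : ℝ) = 3 * (1 + 1 / 3) by norm_num, mul_rpow (by norm_num) (by norm_num),
      rpow_sub_one (by norm_num)]
    ring
  rw [e]
  have h3 : (0 : ℝ) < 3 ^ (r - 1) := by positivity
  nlinarith

/-- **Moment comparison for centered log-concave variables.** If `Y` is centered and
log-concave then for all `p ≥ q ≥ 2`, `(E|Y|^p)^(1/p) ≤ 2·(p/q)·(E|Y|^q)^(1/q)`. -/
theorem centered_logconcave_moment_comparison (μ : Measure Ω) [IsProbabilityMeasure μ]
    (Y : Ω → ℝ) (hmeas : Measurable Y) (hlc : IsLogConcaveRV μ Y)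
    (hcent : ∫ ω, Y ω ∂μ = 0) (p q : ℝ) (hq : 2 ≤ q) (hpq : q ≤ p) :
    (∫ ω, |Y ω| ^ p ∂μ) ^ (1 / p) ≤ 2 * (p / q) * (∫ ω, |Y ω| ^ q ∂μ) ^ (1 / q) := by
  have hq0 : 0 < q := by linarith
  have hp0 : 0 < p := by linarith
  have hint : Integrable Y μ := by
    have h := (integrable_max_zero_rpow hmeas hlc one_pos).add
      (integrable_max_zero_rpow hmeas.neg hlc.neg one_pos)
    refine Integrable.mono' h hmeas.aestronglyMeasurable (Filter.Eventually.of_forall fun ω => ?_)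
    have := abs_rpow_eq_max_add_max one_pos (Y ω)
    rw [rpow_one] at this
    exact this.le
  have hsplit : ∀ s : ℝ, 0 < s → ∫ ω, |Y ω| ^ s ∂μ =
      ∫ ω, max (Y ω) 0 ^ s ∂μ + ∫ ω, max (-Y ω) 0 ^ s ∂μ := fun s hs => by
    have hneg : Integrable (fun ω => max (-Y ω) 0 ^ s) μ :=
      integrable_max_zero_rpow hmeas.neg hlc.neg hs
    rw [← integral_add (integrable_max_zero_rpow hmeas hlc hs) hneg]
    exact integral_congr_ae (Filter.Eventually.of_forall fun ω => abs_rpow_eq_max_add_max hs _)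
  have hr1 : 1 ≤ p / q := (one_le_div hq0).2 hpq
  have bound : ∀ Z : Ω → ℝ, Measurable Z → IsLogConcaveRV μ Z → Integrable Z μ →
      ∫ ω, Z ω ∂μ = 0 → ∫ ω, max (Z ω) 0 ^ p ∂μ ≤
        (p / q) ^ p * (p / q) * 3 ^ (p / q - 1) * (∫ ω, max (Z ω) 0 ^ q ∂μ) ^ (p / q) := by
    intro Z hZ hZlc hZint hZc
    have h3 := one_third_le_upperTail_zero hZ hZlc hZint hZc
    refine (integral_max_zero_rpow_le hZ hZlc (by linarith) hq0 hpq).trans ?_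
    have hM : 0 ≤ ∫ ω, max (Z ω) 0 ^ q ∂μ :=
      integral_nonneg fun ω => rpow_nonneg (le_max_right _ _) _
    gcongr
    calc upperTail μ Z 0 ^ (1 - p / q) ≤ (1 / 3) ^ (1 - p / q) :=
          rpow_le_rpow_of_nonpos (by norm_num) h3 (by linarith)
      _ = 3 ^ (p / q - 1) := by
          rw [one_div, inv_rpow (by norm_num), ← rpow_neg (by norm_num), neg_sub]
  have hA := bound Y hmeas hlc hint hcent
  have hB := bound (fun ω => -Y ω) hmeas.neg hlc.neg hint.neg (by rw [integral_neg, hcent, neg_zero])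
  have hA0 : 0 ≤ ∫ ω, max (Y ω) 0 ^ q ∂μ :=
    integral_nonneg fun ω => rpow_nonneg (le_max_right _ _) _
  have hB0 : 0 ≤ ∫ ω, max (-Y ω) 0 ^ q ∂μ :=
    integral_nonneg fun ω => rpow_nonneg (le_max_right _ _) _
  have hN : 0 ≤ ∫ ω, |Y ω| ^ p ∂μ := integral_nonneg fun ω => rpow_nonneg (abs_nonneg _) _
  have hM : 0 ≤ ∫ ω, |Y ω| ^ q ∂μ := integral_nonneg fun ω => rpow_nonneg (abs_nonneg _) _
  have hadd := add_rpow_le_rpow_add hA0 hB0 hr1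
  rw [← hsplit q hq0] at hadd
  set M := ∫ ω, |Y ω| ^ q ∂μ
  have h42 : (4 : ℝ) ^ (p / q) ≤ 2 ^ p := by
    rw [show (4 : ℝ) = 2 ^ (2 : ℝ) by norm_num, ← rpow_mul (by norm_num)]
    refine rpow_le_rpow_of_exponent_le (by norm_num) ?_
    rw [mul_div_assoc', div_le_iff₀ hq0]
    nlinarith
  have main : ∫ ω, |Y ω| ^ p ∂μ ≤ (2 * (p / q) * M ^ (1 / q)) ^ p := by
    rw [mul_rpow (by positivity) (by positivity), mul_rpow (by norm_num) (by positivity),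
      ← rpow_mul hM, one_div_mul_eq_div, hsplit p hp0]
    calc _ ≤ (p / q) ^ p * (p / q * 3 ^ (p / q - 1)) *
          ((∫ ω, max (Y ω) 0 ^ q ∂μ) ^ (p / q) + (∫ ω, max (-Y ω) 0 ^ q ∂μ) ^ (p / q)) := by
          linarith
      _ ≤ (p / q) ^ p * 2 ^ p * M ^ (p / q) := by
          gcongr
          exact (mul_three_rpow_le_four_rpow hr1).trans h42
      _ = _ := by ring
  calc _ ≤ ((2 * (p / q) * M ^ (1 / q)) ^ p) ^ (1 / p) := by gcongr
    _ = _ := by rw [← rpow_mul (by positivity), mul_one_div_cancel hp0.ne', rpow_one]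

end
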